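/- Let G be an MN3P5 graph that has a dominating 5-hole (an induced cycle on five vertices whose vertex set is a dominating set). Then either G has a dominating clique of size 3, or G is isomorphic to one of the six graphs K4, W5, S1, S2, T, B (the members of the family 𝔊). -/

import Mathlib

open SimpleGraph

/-- Build a simple graph on `Fin n` from a list of edges (symmetrized, loops removed). -/
def graphOfList {n : ℕ} (l : List (Fin n × Fin n)) : SimpleGraph (Fin n) :=
  SimpleGraph.fromRel (fun a b => (a, b) ∈ l)

/-- `K4`: the complete graph on four vertices. -/
def graphK4 : SimpleGraph (Fin 4) := ⊤

/-- `W5`: a 5-cycle `0,1,2,3,4` plus a hub `5` adjacent to all cycle vertices. -/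
def graphW5 : SimpleGraph (Fin 6) :=
  graphOfList [(0,1),(1,2),(2,3),(3,4),(4,0),(5,0),(5,1),(5,2),(5,3),(5,4)]

/-- `S1`: 5-cycle `v1..v5 = 0..4`, `u2 = 5` adjacent exactly to `v1,v2,v3`,
`u5 = 6` adjacent exactly to `v1,v4,v5`. -/
def graphS1 : SimpleGraph (Fin 7) :=
  graphOfList [(0,1),(1,2),(2,3),(3,4),(4,0),(5,0),(5,1),(5,2),(6,0),(6,3),(6,4)]

/-- `S2`: 5-cycle `v1..v5 = 0..4`, `w = 5` adjacent exactly to `v2,v3,v4,v5`,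
`x = 6` adjacent exactly to `v1,v3,v4`. -/
def graphS2 : SimpleGraph (Fin 7) :=
  graphOfList [(0,1),(1,2),(2,3),(3,4),(4,0),(5,1),(5,2),(5,3),(5,4),(6,0),(6,2),(6,3)]

/-- `T`: vertices `u1,uA,uB,u2 = 0,1,2,3`, `w1,wA,wB,w2 = 4,5,6,7`, `x1,x2 = 8,9`. -/
def graphT : SimpleGraph (Fin 10) :=
  graphOfList [(0,1),(0,2),(1,2),(1,3),(2,3),
               (4,5),(4,6),(5,6),(5,7),(6,7),
               (0,4),(0,7),(3,4),(3,7),(1,5),(2,6),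
               (8,0),(8,2),(8,4),(8,5),(8,9),
               (9,1),(9,3),(9,6),(9,7)]

/-- `B`: vertices `w = 0`, `u0..u5 = 1..6`, `v0..v5 = 7..12`, with its 39 edges. -/
def graphB : SimpleGraph (Fin 13) :=
  graphOfList [(0,2),(0,3),(0,6),(0,8),(0,9),(0,12),
               (1,2),(1,3),(1,4),(1,6),(1,8),(1,12),
               (2,3),(2,4),(2,5),(2,7),
               (3,9),(3,10),(3,11),
               (4,6),(4,9),(4,10),(4,11),
               (5,6),(5,9),(5,10),(5,11),(5,12),
               (6,7),(6,11),
               (7,8),(7,9),(7,10),(7,12),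
               (8,9),(8,10),(8,11),
               (10,12),(11,12)]

/-- `G` contains an induced copy of the path `P5` on five vertices. -/
def HasInducedP5 {V : Type*} (G : SimpleGraph V) : Prop :=
  ∃ f : Fin 5 ↪ V, ∀ a b : Fin 5, (SimpleGraph.pathGraph 5).Adj a b ↔ G.Adj (f a) (f b)

/-- `G` is `P5`-free: it has no induced subgraph isomorphic to `P5`. -/
def P5Free {V : Type*} (G : SimpleGraph V) : Prop := ¬ HasInducedP5 G

/-- `G` is an MN3P5 graph: `P5`-free, not 3-colorable, and every proper subgraph
is 3-colorable or contains an induced `P5`. -/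
def IsMN3P5 {V : Type*} (G : SimpleGraph V) : Prop :=
  P5Free G ∧ ¬ G.Colorable 3 ∧
  ∀ H : G.Subgraph, H ≠ ⊤ → (H.coe.Colorable 3 ∨ HasInducedP5 H.coe)

/-- `G` is isomorphic to one of the six graphs `K4, W5, S1, S2, T, B`. -/
def IsoToSix {V : Type*} (G : SimpleGraph V) : Prop :=
  Nonempty (G ≃g graphK4) ∨ Nonempty (G ≃g graphW5) ∨ Nonempty (G ≃g graphS1) ∨
  Nonempty (G ≃g graphS2) ∨ Nonempty (G ≃g graphT) ∨ Nonempty (G ≃g graphB)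

/-- `v` traces a 5-hole (an induced 5-cycle) in `G`. -/
def IsFiveHole {V : Type*} (G : SimpleGraph V) (v : Fin 5 → V) : Prop :=
  Function.Injective v ∧ ∀ i j : Fin 5, G.Adj (v i) (v j) ↔ (j = i + 1 ∨ i = j + 1)

/-- `{a, b, c}` is a dominating clique of size 3 in `G`. -/
def IsDomClique3 {V : Type*} (G : SimpleGraph V) (a b c : V) : Prop :=
  a ≠ b ∧ a ≠ c ∧ b ≠ c ∧ G.Adj a b ∧ G.Adj a c ∧ G.Adj b c ∧
  ∀ x : V, x ≠ a → x ≠ b → x ≠ c → (G.Adj x a ∨ G.Adj x b ∨ G.Adj x c)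

/-- `H` is a subgraph of `G` (deleting vertices and edges): there is an injection of
vertices carrying edges to edges. -/
def ContainsSub {V W : Type*} (G : SimpleGraph V) (H : SimpleGraph W) : Prop :=
  ∃ f : W ↪ V, ∀ a b : W, H.Adj a b → G.Adj (f a) (f b)

/-- `G` is minimally non-`k`-colorable: not `k`-colorable, but every proper subgraph is. -/
def MinNonColorable {V : Type*} (k : ℕ) (G : SimpleGraph V) : Prop :=
  ¬ G.Colorable k ∧ ∀ H : G.Subgraph, H ≠ ⊤ → H.coe.Colorable k

section Critical

variable {V W : Type*} {G : SimpleGraph V}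

theorem HasInducedP5.of_path {a b c d e : V} (hac : a ≠ c) (had : a ≠ d) (hae : a ≠ e)
    (hbd : b ≠ d) (hbe : b ≠ e) (hce : c ≠ e) (ab : G.Adj a b) (bc : G.Adj b c) (cd : G.Adj c d)
    (de : G.Adj d e) (nac : ¬ G.Adj a c) (nad : ¬ G.Adj a d) (nae : ¬ G.Adj a e)
    (nbd : ¬ G.Adj b d) (nbe : ¬ G.Adj b e) (nce : ¬ G.Adj c e) : HasInducedP5 G := by
  have hab := ab.ne
  have hbc := bc.ne
  have hcd := cd.ne
  have hde := de.ne
  have hadj : ∀ i j, (SimpleGraph.pathGraph 5).Adj i j ↔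
      G.Adj (![a, b, c, d, e] i) (![a, b, c, d, e] j) := by
    intro i j
    fin_cases i <;> fin_cases j <;> simp_all [SimpleGraph.pathGraph_adj, G.adj_comm]
  refine ⟨⟨![a, b, c, d, e], fun i j h => ?_⟩, hadj⟩
  fin_cases i <;> fin_cases j <;> simp_all [eq_comm]

theorem HasInducedP5.exists_path (h : HasInducedP5 G) :
    ∃ a b c d e : V, a ≠ c ∧ G.Adj a b ∧ G.Adj b c ∧ G.Adj c d ∧ G.Adj d e ∧ ¬ G.Adj a c ∧
      ¬ G.Adj a d ∧ ¬ G.Adj a e ∧ ¬ G.Adj b d ∧ ¬ G.Adj b e ∧ ¬ G.Adj c e := by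
  obtain ⟨f, hf⟩ := h
  refine ⟨f 0, f 1, f 2, f 3, f 4, f.injective.ne (by decide), ?_⟩
  simp only [← hf, SimpleGraph.pathGraph_adj]
  decide

theorem HasInducedP5.map {H : SimpleGraph W} (h : HasInducedP5 H) (f : H ↪g G) :
    HasInducedP5 G := by
  obtain ⟨g, hg⟩ := h
  exact ⟨g.trans f.toEmbedding, fun a b => (hg a b).trans f.map_adj_iff.symm⟩

theorem IsMN3P5.exists_coloring_compl (hG : IsMN3P5 G) (u : V) :
    ∃ c : V → Fin 3, ∀ a b, a ≠ u → b ≠ u → G.Adj a b → c a ≠ c b := by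
  classical
  let H : G.Subgraph := (⊤ : G.Subgraph).induce {u}ᶜ
  have hH : H ≠ ⊤ := fun h => by
    have : u ∈ H.verts := h ▸ Set.mem_univ u
    exact this rfl
  have hadj : ∀ a b : H.verts, H.coe.Adj a b ↔ G.Adj a b := fun a b =>
    ⟨fun (h : H.Adj a b) => h.adj_sub, fun h => ⟨a.2, b.2, h⟩⟩
  rcases hG.2.2 H hH with ⟨⟨c⟩⟩ | h
  · refine ⟨fun a => if ha : a ≠ u then c ⟨a, ha⟩ else 0, fun a b ha hb hab => ?_⟩
    simp only [ne_eq, ha, hb, not_false_eq_true, dite_true]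
    exact c.valid ((hadj ⟨a, ha⟩ ⟨b, hb⟩).2 hab)
  · exact absurd (h.map ⟨Function.Embedding.subtype _, fun {a b} => (hadj a b).symm⟩) hG.1

theorem IsMN3P5.not_coloring (hG : IsMN3P5 G) (c : V → Fin 3) :
    ∃ a b, G.Adj a b ∧ c a = c b := by
  by_contra! h
  exact hG.2.1 ⟨SimpleGraph.Coloring.mk c fun {a b} => h a b⟩

/-- The neighbours of a vertex use all three colours in a colouring of the rest of the graph. -/
theorem IsMN3P5.exists_adj_color (hG : IsMN3P5 G) {u : V} {c : V → Fin 3}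
    (hc : ∀ a b, a ≠ u → b ≠ u → G.Adj a b → c a ≠ c b) (i : Fin 3) :
    ∃ x, G.Adj u x ∧ c x = i := by
  classical
  by_contra! h
  obtain ⟨a, b, hab, hcol⟩ := hG.not_coloring (Function.update c u i)
  rcases eq_or_ne a u with rfl | ha
  · exact h b hab (by simpa [hab.ne'] using hcol.symm)
  · rcases eq_or_ne b u with rfl | hb
    · exact h a hab.symm (by simpa [ha] using hcol)
    · exact hc a b ha hb hab (by simpa [ha, hb] using hcol)

theorem IsMN3P5.exists_adj_not_adj (hG : IsMN3P5 G) {u v : V} (huv : u ≠ v) :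
    ∃ x, G.Adj u x ∧ ¬ G.Adj v x := by
  obtain ⟨c, hc⟩ := hG.exists_coloring_compl u
  obtain ⟨x, hux, hx⟩ := hG.exists_adj_color hc (c v)
  exact ⟨x, hux, fun hvx => hc v x huv.symm hux.ne' hvx hx.symm⟩

theorem IsMN3P5.exists_adj_ne_ne (hG : IsMN3P5 G) (u v w : V) :
    ∃ x, G.Adj u x ∧ x ≠ v ∧ x ≠ w := by
  obtain ⟨c, hc⟩ := hG.exists_coloring_compl u
  have : ∀ p q : Fin 3, ∃ i, i ≠ p ∧ i ≠ q := by decide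
  obtain ⟨i, hv, hw⟩ := this (c v) (c w)
  obtain ⟨x, hux, rfl⟩ := hG.exists_adj_color hc i
  exact ⟨x, hux, fun h => hv (h ▸ rfl), fun h => hw (h ▸ rfl)⟩

theorem IsMN3P5.nonempty_iso (hG : IsMN3P5 G) {H : SimpleGraph W} (hP : P5Free H)
    (hcol : ¬ H.Colorable 3) (hH : ContainsSub G H) : Nonempty (G ≃g H) := by
  obtain ⟨f, hf⟩ := hH
  let φ : H →g G := ⟨f, fun {a b} => hf a b⟩
  let K : G.Subgraph := (⊤ : H.Subgraph).map φ
  have hadj : ∀ a b, K.Adj (f a) (f b) ↔ H.Adj a b := fun a b => by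
    constructor
    · rintro ⟨a', b', h, ha, hb⟩
      rw [← f.injective ha, ← f.injective hb]
      exact h
    · exact fun h => ⟨a, b, h, rfl, rfl⟩
  have hmem : ∀ a, f a ∈ K.verts := fun a => ⟨a, Set.mem_univ a, rfl⟩
  let e : W ≃ K.verts := Equiv.ofBijective (fun a => ⟨f a, hmem a⟩)
    ⟨fun a b h => f.injective (congrArg Subtype.val h),
      fun ⟨_, a, _, ha⟩ => ⟨a, Subtype.ext ha⟩⟩
  let i : H ≃g K.coe := ⟨e, fun {a b} => hadj a b⟩
  have htop : K = ⊤ := by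
    by_contra hK
    rcases hG.2.2 K hK with h | h
    · exact hcol (h.of_hom i.toHom)
    · exact hP (h.map i.symm.toEmbedding)
  have hsurj : Function.Surjective f := fun x => by
    have : x ∈ K.verts := htop ▸ Set.mem_univ x
    obtain ⟨a, _, ha⟩ := this
    exact ⟨a, ha⟩
  have htop' : ∀ x y, K.Adj x y ↔ G.Adj x y := fun x y => by rw [htop]; rfl
  exact ⟨(⟨Equiv.ofBijective f ⟨f.injective, hsurj⟩, fun {a b} =>
    (htop' _ _).symm.trans (hadj a b)⟩ : H ≃g G).symm⟩

end Critical

theorem p5Free_graphK4 : P5Free graphK4 := fun h => by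
  obtain ⟨a, b, c, d, e, hac, h⟩ := h.exists_path
  exact h.2.2.2.2.1 hac

theorem not_colorable_graphK4 : ¬ graphK4.Colorable 3 := fun h => by
  have := h.card_le_of_pairwise_adj (V := Fin 4) id fun _ _ h => h
  simp at this

theorem graphS1_adj (a b : Fin 7) : graphS1.Adj a b ↔ a ≠ b ∧
    ((a, b) ∈ [((0 : Fin 7), (1 : Fin 7)), (1, 2), (2, 3), (3, 4), (4, 0), (5, 0), (5, 1), (5, 2),
      (6, 0), (6, 3), (6, 4)] ∨ (b, a) ∈ [((0 : Fin 7), (1 : Fin 7)), (1, 2), (2, 3), (3, 4),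
      (4, 0), (5, 0), (5, 1), (5, 2), (6, 0), (6, 3), (6, 4)]) := Iff.rfl

instance : DecidableRel graphS1.Adj := fun a b => decidable_of_iff' _ (graphS1_adj a b)

theorem p5Free_graphS1 : P5Free graphS1 := fun h => by
  obtain ⟨a, b, c, d, e, -, ab, bc, cd, de, nac, nad, nae, nbd, nbe, nce⟩ := h.exists_path
  have key : ∀ a b, graphS1.Adj a b → ∀ c, graphS1.Adj b c → ¬ graphS1.Adj a c →
      ∀ d, graphS1.Adj c d → ¬ graphS1.Adj a d → ¬ graphS1.Adj b d →
      ∀ e, graphS1.Adj d e → ¬ graphS1.Adj a e → ¬ graphS1.Adj b e → graphS1.Adj c e := by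
    decide +kernel
  exact nce (key a b ab c bc nac d cd nad nbd e de nae nbe)

theorem not_colorable_graphS1 : ¬ graphS1.Colorable 3 := by
  rintro ⟨c⟩
  have h : ∀ a b, graphS1.Adj a b → c a ≠ c b := fun a b => c.valid
  have := h 0 1 (by decide)
  have := h 1 2 (by decide)
  have := h 2 3 (by decide)
  have := h 3 4 (by decide)
  have := h 4 0 (by decide)
  have := h 5 0 (by decide)
  have := h 5 1 (by decide)
  have := h 5 2 (by decide)
  have := h 6 0 (by decide)
  have := h 6 3 (by decide)
  have := h 6 4 (by decide)
  omega

section Patterns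

variable {V : Type*} {G : SimpleGraph V}

theorem ContainsSub.of_clique {a b c d : V} (ab : G.Adj a b) (ac : G.Adj a c) (ad : G.Adj a d)
    (bc : G.Adj b c) (bd : G.Adj b d) (cd : G.Adj c d) : ContainsSub G graphK4 := by
  have hadj : ∀ i j, i ≠ j → G.Adj (![a, b, c, d] i) (![a, b, c, d] j) := by
    intro i j h
    fin_cases i <;> fin_cases j <;> simp_all [G.adj_comm]
  refine ⟨⟨![a, b, c, d], fun i j h => ?_⟩, hadj⟩
  by_contra hij
  exact (hadj i j hij).ne h

/-- Two diamonds sharing the vertex `a` whose other vertices of degree two are adjacent. -/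
theorem ContainsSub.of_spindle {a b c d e x y : V} (ab : G.Adj a b) (bc : G.Adj b c)
    (cd : G.Adj c d) (de : G.Adj d e) (ea : G.Adj e a) (xa : G.Adj x a) (xb : G.Adj x b)
    (xc : G.Adj x c) (ya : G.Adj y a) (yd : G.Adj y d) (ye : G.Adj y e) (hac : a ≠ c)
    (had : a ≠ d) (hbd : b ≠ d) (hbe : b ≠ e) (hby : b ≠ y) (hce : c ≠ e) (hcy : c ≠ y)
    (hxd : x ≠ d) (hxe : x ≠ e) (hxy : x ≠ y) : ContainsSub G graphS1 := by
  have := ab.ne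
  have := bc.ne
  have := cd.ne
  have := de.ne
  have := ea.ne
  have := xa.ne
  have := xb.ne
  have := xc.ne
  have := ya.ne
  have := yd.ne
  have := ye.ne
  have hadj : ∀ i j, graphS1.Adj i j →
      G.Adj (![a, b, c, d, e, x, y] i) (![a, b, c, d, e, x, y] j) := by
    intro i j
    rw [graphS1_adj]
    fin_cases i <;> fin_cases j <;> simp [*, ab.symm, bc.symm, cd.symm, de.symm, ea.symm,
      xa.symm, xb.symm, xc.symm, ya.symm, yd.symm, ye.symm]
  refine ⟨⟨![a, b, c, d, e, x, y], fun i j h => ?_⟩, hadj⟩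
  fin_cases i <;> fin_cases j <;> first | rfl | (exfalso; simp at h; subst h; contradiction)

end Patterns

namespace MaskSearch

/-- The relation required between a new vertex of a pattern and an earlier one. -/
inductive Link
  | adj
  | nonadj
  | distinct

/-- `k n`, written so that kernel reduction evaluates `n` first. -/
noncomputable def withNat {α : Type*} (n : ℕ) (k : ℕ → α) : α :=
  match n with
  | 0 => k 0
  | m + 1 => k (m + 1)

/-- `k l`, written so that kernel reduction evaluates `l` first. -/
noncomputable def withList {α : Type*} : List ℕ → (List ℕ → α) → α
  | [], k => k []
  | a :: l, k => withNat a fun a => withList l fun l => k (a :: l)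

/-- Add the bits of `c` as new lowest bits of the entries of a list. -/
noncomputable def pushBits : ℕ → List ℕ → List ℕ
  | _, [] => []
  | c, r :: rs => (2 * r + c % 2) :: pushBits (c / 2) rs

/-- The adjacency rows after adding a new first vertex with neighbourhood mask `c`. -/
noncomputable def extend (c : ℕ) (A : List ℕ) : List ℕ := 2 * c :: pushBits c A

/-- Whether some row selected by the mask `c` satisfies `p`; the second argument of `p` is the bit
of the row, and `b` is the bit of the first row. -/
noncomputable def anyRow (p : ℕ → ℕ → Bool) (c b : ℕ) (A : List ℕ) : Bool :=
  A.rec (motive := fun _ => ℕ → ℕ → Bool) (fun _ _ => false)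
    (fun r _ ih c b => bif Nat.beq c 0 then false else
      bif bif Nat.beq (Nat.mod c 2) 0 then false else p r b then true else
        ih (Nat.div c 2) (Nat.mul 2 b)) c b

/-- The mask of the vertices linked as prescribed to the vertices already placed, each of which is
given by its row and its bit. -/
noncomputable def candMask (all : ℕ) (s : List Link) : List (ℕ × ℕ) → ℕ :=
  s.rec (fun _ => all) fun l _ ih placed => placed.rec all fun p ps _ =>
    Nat.land (l.rec p.1 (Nat.xor all (Nat.lor p.1 p.2)) (Nat.xor all p.2)) (ih ps)

/-- Whether the vertices already placed can be completed to a copy of the pattern. -/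
noncomputable def matches? (A : List ℕ) (all : ℕ) (ss : List (List Link)) : List (ℕ × ℕ) → Bool :=
  ss.rec (fun _ => true) fun s _ ih placed =>
    withNat (candMask all s placed) fun c => anyRow (fun r b => ih ((r, b) :: placed)) c 1 A

open Link in
/-- The graphs `K4`, `P5` (induced) and `S1`, once for each orbit of the vertex placed first. -/
noncomputable def patterns : List (List (List Link)) :=
  [[[adj], [adj, adj], [adj, adj, adj]],
   [[adj], [adj, nonadj], [adj, nonadj, nonadj], [adj, nonadj, nonadj, nonadj]],
   [[adj], [nonadj, adj], [adj, nonadj, nonadj], [adj, nonadj, nonadj, nonadj]],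
   [[adj], [nonadj, adj], [nonadj, adj, nonadj], [nonadj, adj, nonadj, nonadj]],
   [[adj], [adj, adj], [adj, adj, distinct], [adj, distinct, distinct, distinct],
     [adj, distinct, distinct, distinct, adj], [adj, adj, distinct, distinct, distinct, adj]],
   [[adj], [adj, adj], [adj, distinct, adj], [adj, distinct, distinct, distinct],
     [adj, distinct, distinct, adj, distinct], [adj, adj, distinct, distinct, adj, distinct]],
   [[adj], [adj, adj], [adj, adj, distinct], [distinct, distinct, distinct, adj],
     [adj, adj, distinct, distinct, distinct], [adj, adj, adj, distinct, distinct, distinct]]]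

/-- Whether the first vertex lies in a copy of one of the patterns. -/
noncomputable def bad : List ℕ → Bool
  | [] => false
  | r :: rs => withNat (2 ^ (r :: rs).length - 1) fun all =>
    patterns.any fun s => matches? (r :: rs) all s [(r, 1)]

/-- Lists of vertices which some outside vertex must be adjacent, respectively nonadjacent, to:
because of two vertices with comparable neighbourhoods, of a vertex of degree at most two, or of a
dominating triangle. -/
noncomputable def demands (A : List ℕ) : List (List ℕ × List ℕ) :=
  (A.zipIdx.flatMap fun p => A.zipIdx.filterMap fun q =>
    if p.1 &&& q.1 == p.1 && p.2 != q.2 then some ([p.2], [q.2]) else none) ++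
  (A.zipIdx.filterMap fun p =>
    if p.1 &&& (2 ^ p.1.log2 ||| 2 ^ (p.1 - 2 ^ p.1.log2).log2) == p.1 then some ([p.2], [])
    else none) ++
  (A.zipIdx.flatMap fun p => (A.zipIdx.filter fun q => p.1.testBit q.2).flatMap fun q =>
    A.zipIdx.filterMap fun t =>
      if p.1.testBit t.2 && q.1.testBit t.2 && p.1 ||| q.1 ||| t.1 == 2 ^ A.length - 1 then
        some ([], [p.2, q.2, t.2]) else none)

/-- Whether a neighbourhood mask meets a demand. -/
noncomputable def fits (o : List ℕ × List ℕ) (m : ℕ) : Bool :=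
  o.1.all m.testBit && o.2.all fun i => !m.testBit i

/-- A shortest member of a list of lists. -/
noncomputable def shortest? : List (List ℕ) → Option (List ℕ)
  | [] => none
  | l :: ls => match shortest? ls with
    | none => some l
    | some l' => if l.length ≤ l'.length then some l else some l'

/-- The possible neighbourhood masks after adding a vertex with neighbourhood mask `c`. -/
noncomputable def children (A cands : List ℕ) (c : ℕ) : List ℕ :=
  (cands.flatMap fun m => [2 * m, 2 * m + 1]).filter fun m => !withList (extend m (extend c A)) bad

/-- Run `next` after adding a vertex whose neighbourhood mask is the first member of the list that
occurs. -/
noncomputable def branch (next : List ℕ → List ℕ → Bool) (A : List ℕ) : List ℕ → List ℕ → Bool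
  | [], _ => true
  | c :: todo, cands =>
    withList (extend c A) (fun A' => withList (children A cands c) (next A')) &&
      branch next A todo (cands.filter (· != c))

/-- Search of bounded depth for a graph which contains the graph with rows `A` as an induced
subgraph, with the outside neighbourhood masks in `cands`; `true` means that there is none. -/
noncomputable def search : ℕ → List ℕ → List ℕ → Bool
  | 0, _, _ => false
  | k + 1, A, cands =>
    match shortest? ((demands A).map fun o => cands.filter (fits o)) with
    | none => false
    | some todo => withList todo fun todo => branch (search k) A todo cands

/-- The rows of the 5-hole. -/
noncomputable def holeRows : List ℕ := [18, 5, 10, 20, 9]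

/-- The possible neighbourhood masks outside a dominating 5-hole. -/
noncomputable def holeCands : List ℕ :=
  (List.range 32).filter fun m => m != 0 && !withList (extend m holeRows) bad

theorem withNat_eq {α : Type*} (n : ℕ) (k : ℕ → α) : withNat n k = k n := by
  cases n <;> rfl

theorem withList_eq {α : Type*} (l : List ℕ) (k : List ℕ → α) : withList l k = k l := by
  induction l generalizing k with
  | nil => rfl
  | cons a l ih => simp only [withList, withNat_eq, ih]

variable {V : Type*} {G : SimpleGraph V}

open Classical in
/-- The neighbourhood of a vertex in a list of vertices, as a bit mask. -/
noncomputable def nbrMask (G : SimpleGraph V) : List V → V → ℕ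
  | [], _ => 0
  | v :: t, x => 2 * nbrMask G t x + if G.Adj x v then 1 else 0

theorem testBit_nbrMask {f : List V} {x : V} {i : ℕ} :
    (nbrMask G f x).testBit i = true ↔ ∃ w, f[i]? = some w ∧ G.Adj x w := by
  induction f generalizing i with
  | nil => simp [nbrMask]
  | cons v t ih =>
    cases i with
    | zero =>
      by_cases h : G.Adj x v <;> simp [nbrMask, h]
    | succ i =>
      have : nbrMask G (v :: t) x / 2 = nbrMask G t x := by
        rw [nbrMask]
        split_ifs <;> omega
      rw [Nat.testBit_succ, this, ih, List.getElem?_cons_succ]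

theorem testBit_nbrMask_of_getElem? {f : List V} {x w : V} {i : ℕ} (h : f[i]? = some w) :
    (nbrMask G f x).testBit i = true ↔ G.Adj x w := by
  simp [testBit_nbrMask, h]

/-- The adjacency rows of the subgraph induced by a list of vertices. -/
noncomputable def rows (G : SimpleGraph V) (f : List V) : List ℕ := f.map (nbrMask G f)

open Classical in
theorem pushBits_nbrMask (s : List V) (v : V) (g : V → ℕ) :
    pushBits (nbrMask G s v) (s.map g) =
      s.map fun w => 2 * g w + if G.Adj w v then 1 else 0 := by
  induction s with
  | nil => rfl
  | cons w s ih =>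
    have h₁ : nbrMask G (w :: s) v / 2 = nbrMask G s v := by
      rw [nbrMask]
      split_ifs <;> omega
    have h₂ : nbrMask G (w :: s) v % 2 = if G.Adj w v then 1 else 0 := by
      rw [nbrMask]
      simp only [G.adj_comm v w]
      split_ifs <;> omega
    simp only [List.map_cons, pushBits, h₁, h₂, ih]

theorem rows_cons (v : V) (t : List V) :
    rows G (v :: t) = extend (nbrMask G t v) (rows G t) := by
  simp [rows, extend, pushBits_nbrMask, nbrMask]

theorem getElem?_rows {f : List V} {i r : ℕ} :
    (rows G f)[i]? = some r ↔ ∃ w, f[i]? = some w ∧ nbrMask G f w = r := by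
  simp [rows]

theorem getElem?_inj_of_nodup {f : List V} (hf : f.Nodup) {i j : ℕ} {v : V}
    (hi : f[i]? = some v) (hj : f[j]? = some v) : i = j := by
  obtain ⟨hi', hi⟩ := List.getElem?_eq_some_iff.1 hi
  obtain ⟨hj', hj⟩ := List.getElem?_eq_some_iff.1 hj
  exact (hf.getElem_inj_iff).1 (hi.trans hj.symm)

theorem anyRow_cons (p : ℕ → ℕ → Bool) (c b r : ℕ) (A : List ℕ) :
    anyRow p c b (r :: A) = bif Nat.beq c 0 then false else
      bif bif Nat.beq (c % 2) 0 then false else p r b then true else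
        anyRow p (c / 2) (2 * b) A := rfl

theorem exists_of_anyRow {p : ℕ → ℕ → Bool} {c b : ℕ} {A : List ℕ}
    (h : anyRow p c b A = true) :
    ∃ i r, A[i]? = some r ∧ c.testBit i = true ∧ p r (b * 2 ^ i) = true := by
  induction A generalizing c b with
  | nil => exact absurd h Bool.false_ne_true
  | cons r A ih =>
    rw [anyRow_cons] at h
    by_cases hp : c % 2 ≠ 0 ∧ p r b = true
    · refine ⟨0, r, rfl, ?_, by simpa using hp.2⟩
      simpa using hp.1
    · have h' : anyRow p (c / 2) (2 * b) A = true := by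
        cases h0 : Nat.beq c 0 <;> cases h2 : Nat.beq (c % 2) 0 <;> cases h3 : p r b <;>
          simp_all
      obtain ⟨i, r', hA, hc, hr⟩ := ih h'
      refine ⟨i + 1, r', hA, by rwa [Nat.testBit_succ], ?_⟩
      rwa [pow_succ', ← mul_assoc, mul_comm b 2]

/-- The vertex `v` is linked as prescribed to the given vertices. -/
def Linked (G : SimpleGraph V) (v : V) : List Link → List V → Prop
  | .adj :: s, w :: ws => G.Adj v w ∧ Linked G v s ws
  | .nonadj :: s, w :: ws => v ≠ w ∧ ¬ G.Adj v w ∧ Linked G v s ws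
  | .distinct :: s, w :: ws => v ≠ w ∧ Linked G v s ws
  | _, _ => True

/-- The given vertices can be completed to a copy of the pattern. -/
def Completes (G : SimpleGraph V) : List (List Link) → List V → Prop
  | [], _ => True
  | s :: ss, ws => ∃ v, Linked G v s ws ∧ Completes G ss (v :: ws)

/-- The pair consists of the row and the bit of the vertex `w`. -/
def IsRowBit (G : SimpleGraph V) (f : List V) (p : ℕ × ℕ) (w : V) : Prop :=
  ∃ i, f[i]? = some w ∧ p = (nbrMask G f w, 2 ^ i)

theorem linked_of_testBit_candMask {f : List V} (hf : f.Nodup) {v : V} {j : ℕ}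
    (hv : f[j]? = some v) {placed : List (ℕ × ℕ)} {ws : List V}
    (hws : List.Forall₂ (IsRowBit G f) placed ws) (s : List Link)
    (h : (candMask (2 ^ f.length - 1) s placed).testBit j = true) : Linked G v s ws := by
  induction hws generalizing s with
  | nil => cases s with
    | nil => trivial
    | cons l s => cases l <;> trivial
  | @cons p w ps ws hp _ ih =>
    obtain ⟨i, hi, rfl⟩ := hp
    have hne : i ≠ j → v ≠ w := by
      rintro hij rfl
      exact hij (getElem?_inj_of_nodup hf hi hv)
    rcases s with _ | ⟨_ | _ | _, s⟩
    · trivial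
    · change (nbrMask G f w &&& candMask _ s ps).testBit j = true at h
      rw [Nat.testBit_land, Bool.and_eq_true, testBit_nbrMask_of_getElem? hv] at h
      exact ⟨h.1.symm, ih s h.2⟩
    · change ((_ ^^^ (nbrMask G f w ||| 2 ^ i)) &&& candMask _ s ps).testBit j = true at h
      have hj := (List.getElem?_eq_some_iff.1 hv).1
      have := testBit_nbrMask_of_getElem? (G := G) (x := w) hv
      simp only [Nat.testBit_land, Nat.testBit_xor, Nat.testBit_two_pow_sub_one, hj,
        Nat.testBit_lor, Nat.testBit_two_pow, Bool.and_eq_true] at h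
      refine ⟨hne ?_, fun hvw => ?_, ih s h.2⟩
      · rintro rfl
        simp at h
      · simp [this.2 hvw.symm] at h
    · change ((_ ^^^ 2 ^ i) &&& candMask _ s ps).testBit j = true at h
      have hj := (List.getElem?_eq_some_iff.1 hv).1
      simp only [Nat.testBit_land, Nat.testBit_xor, Nat.testBit_two_pow_sub_one, hj,
        Nat.testBit_two_pow, Bool.and_eq_true] at h
      refine ⟨hne ?_, ih s h.2⟩
      rintro rfl
      simp at h

theorem matches?_cons (A : List ℕ) (all : ℕ) (s : List Link) (ss : List (List Link))
    (placed : List (ℕ × ℕ)) : matches? A all (s :: ss) placed =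
      anyRow (fun r b => matches? A all ss ((r, b) :: placed)) (candMask all s placed) 1 A :=
  withNat_eq (candMask all s placed) fun c =>
    anyRow (fun r b => matches? A all ss ((r, b) :: placed)) c 1 A

theorem completes_of_matches? {f : List V} (hf : f.Nodup) (ss : List (List Link))
    {placed : List (ℕ × ℕ)} {ws : List V} (hws : List.Forall₂ (IsRowBit G f) placed ws)
    (h : matches? (rows G f) (2 ^ f.length - 1) ss placed = true) : Completes G ss ws := by
  induction ss generalizing placed ws with
  | nil => trivial
  | cons s ss ih =>
    rw [matches?_cons] at h
    obtain ⟨i, r, hr, hi, h⟩ := exists_of_anyRow h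
    obtain ⟨v, hv, rfl⟩ := getElem?_rows.1 hr
    exact ⟨v, linked_of_testBit_candMask hf hv hws s hi,
      ih (List.Forall₂.cons ⟨i, hv, by rw [one_mul]⟩ hws) h⟩

/-- The graph contains an induced `P5`, or `K4` or `S1` as a subgraph. -/
def HasPattern (G : SimpleGraph V) : Prop :=
  HasInducedP5 G ∨ ContainsSub G graphK4 ∨ ContainsSub G graphS1

theorem hasPattern_of_completes {s : List (List Link)} (hs : s ∈ patterns) {y : V}
    (h : Completes G s [y]) : HasPattern G := by
  simp only [patterns, List.mem_cons, List.not_mem_nil, or_false] at hs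
  rcases hs with rfl | rfl | rfl | rfl | rfl | rfl | rfl
  · obtain ⟨a, ⟨ha, -⟩, b, ⟨hb₁, hb₂, -⟩, c, ⟨hc₁, hc₂, hc₃, -⟩, -⟩ := h
    exact .inr (.inl (.of_clique ha.symm hb₂.symm hc₃.symm hb₁.symm hc₂.symm hc₁.symm))
  · obtain ⟨b, ⟨hb, -⟩, c, ⟨hcb, hcy, ncy, -⟩, d, ⟨hdc, hdb, ndb, hdy, ndy, -⟩,
      e, ⟨hed, hec, nec, heb, neb, hey, ney, -⟩, -⟩ := h
    exact .inl (.of_path (a := y) (b := b) (c := c) (d := d) (e := e)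
      hcy.symm hdy.symm hey.symm hdb.symm heb.symm hec.symm hb.symm hcb.symm hdc.symm hed.symm
      (ncy ·.symm) (ndy ·.symm) (ney ·.symm) (ndb ·.symm) (neb ·.symm) (nec ·.symm))
  · obtain ⟨a, ⟨ha, -⟩, c, ⟨hca, nca, hcy, -⟩, d, ⟨hdc, hda, nda, hdy, ndy, -⟩,
      e, ⟨hed, hec, nec, hea, nea, hey, ney, -⟩, -⟩ := h
    exact .inl (.of_path (a := a) (b := y) (c := c) (d := d) (e := e)
      hca.symm hda.symm hea.symm hdy.symm hey.symm hec.symm ha hcy.symm hdc.symm hed.symm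
      (nca ·.symm) (nda ·.symm) (nea ·.symm) (ndy ·.symm) (ney ·.symm) (nec ·.symm))
  · obtain ⟨b, ⟨hb, -⟩, d, ⟨hdb, ndb, hdy, -⟩, a, ⟨had, nad, hab, hay, nay, -⟩,
      e, ⟨hea, nea, hed, heb, neb, hey, ney, -⟩, -⟩ := h
    exact .inl (.of_path (a := a) (b := b) (c := y) (d := d) (e := e)
      hay had hea.symm hdb.symm heb.symm hey.symm hab hb hdy.symm hed.symm
      nay nad (nea ·.symm) (ndb ·.symm) (neb ·.symm) (ney ·.symm))
  · obtain ⟨b, ⟨b0, -⟩, x, ⟨xb, x0, -⟩, c, ⟨cx, cb, c0, -⟩, d, ⟨dc, dx, db, d0, -⟩,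
      e, ⟨ed, ec, ex, eb, e0, -⟩, z, ⟨ze, zd, zc, zx, zb, z0, -⟩, -⟩ := h
    exact .inr (.inr (.of_spindle (a := y) (b := b) (c := c) (d := d) (e := e) (x := x) (y := z)
      b0.symm cb.symm dc.symm ed.symm e0 x0 xb cx.symm z0 zd ze c0.symm d0.symm db.symm eb.symm
      zb.symm ec.symm zc.symm dx.symm ex.symm zx.symm))
  · obtain ⟨a, ⟨ab, -⟩, x, ⟨xa, xb, -⟩, c, ⟨cx, ca, cb, -⟩, d, ⟨dc, dx, da, db, -⟩,
      e, ⟨ed, ec, ex, ea, eb, -⟩, z, ⟨ze, zd, zc, zx, za, zb, -⟩, -⟩ := h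
    exact .inr (.inr (.of_spindle (a := a) (b := y) (c := c) (d := d) (e := e) (x := x) (y := z)
      ab cb.symm dc.symm ed.symm ea xa xb cx.symm za zd ze ca.symm da.symm db.symm eb.symm
      zb.symm ec.symm zc.symm dx.symm ex.symm zx.symm))
  · obtain ⟨b, ⟨bc, -⟩, x, ⟨xb, xc, -⟩, a, ⟨ax, ab, ac, -⟩, d, ⟨da, dx, db, dc, -⟩,
      e, ⟨ed, ea, ex, eb, ec, -⟩, z, ⟨ze, zd, za, zx, zb, zc, -⟩, -⟩ := h
    exact .inr (.inr (.of_spindle (a := a) (b := b) (c := y) (d := d) (e := e) (x := x) (y := z)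
      ab bc dc.symm ed.symm ea ax.symm xb xc za zd ze ac da.symm db.symm eb.symm
      zb.symm ec.symm zc.symm dx.symm ex.symm zx.symm))

theorem hasPattern_of_bad {f : List V} (hf : f.Nodup) (h : bad (rows G f) = true) :
    HasPattern G := by
  rcases f with _ | ⟨y, t⟩
  · exact absurd h Bool.false_ne_true
  · have hbad : patterns.any (fun s => matches? (rows G (y :: t)) (2 ^ (y :: t).length - 1) s
        [(nbrMask G (y :: t) y, 1)]) = true := by
      rw [← h, rows, List.map_cons, bad, withNat_eq, List.length_cons, List.length_cons,
        List.length_map]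
    obtain ⟨s, hs, h⟩ := List.any_eq_true.1 hbad
    exact hasPattern_of_completes hs (completes_of_matches? hf s (.cons ⟨0, rfl, rfl⟩ .nil) h)

theorem fits_iff {o : List ℕ × List ℕ} {m : ℕ} :
    fits o m = true ↔ (∀ i ∈ o.1, m.testBit i = true) ∧ ∀ i ∈ o.2, m.testBit i = false := by
  simp [fits]

theorem mem_zipIdx_rows {f : List V} {p : ℕ × ℕ} (hp : p ∈ (rows G f).zipIdx) :
    ∃ w, f[p.2]? = some w ∧ p.1 = nbrMask G f w := by
  rw [List.mem_zipIdx_iff_getElem?] at hp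
  obtain ⟨w, hw, h⟩ := getElem?_rows.1 hp
  exact ⟨w, hw, h.symm⟩

theorem testBit_of_and_eq {m n i : ℕ} (h : m &&& n = m) (hm : m.testBit i = true) :
    n.testBit i = true := by
  rw [← h, Nat.testBit_land, Bool.and_eq_true] at hm
  exact hm.2

theorem exists_fits_of_mem_demands (hG : IsMN3P5 G) (hT : ¬ ∃ a b c, IsDomClique3 G a b c)
    {f : List V} (hf : f.Nodup) {o : List ℕ × List ℕ} (ho : o ∈ demands (rows G f)) :
    ∃ x ∉ f, fits o (nbrMask G f x) = true := by
  rw [demands, List.mem_append, List.mem_append, List.mem_flatMap, List.mem_filterMap,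
    List.mem_flatMap] at ho
  rcases ho with (⟨p, hp, ho⟩ | ⟨p, hp, ho⟩) | ⟨p, hp, ho⟩
  · obtain ⟨q, hq, ho⟩ := List.mem_filterMap.1 ho
    simp only [Option.ite_none_right_eq_some, Bool.and_eq_true, beq_iff_eq, bne_iff_ne,
      Option.some.injEq] at ho
    obtain ⟨⟨hpq, hne⟩, rfl⟩ := ho
    obtain ⟨u, hu, hpu⟩ := mem_zipIdx_rows hp
    obtain ⟨w, hw, hqw⟩ := mem_zipIdx_rows hq
    rw [hpu, hqw] at hpq
    have huw : u ≠ w := by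
      rintro rfl
      exact hne (getElem?_inj_of_nodup hf hu hw)
    obtain ⟨x, hux, hwx⟩ := hG.exists_adj_not_adj huw
    refine ⟨x, fun hx => hwx ?_, fits_iff.2 ⟨?_, ?_⟩⟩
    · obtain ⟨i, hi⟩ := List.getElem?_of_mem hx
      rw [← testBit_nbrMask_of_getElem? hi] at hux ⊢
      exact testBit_of_and_eq hpq hux
    · simpa [testBit_nbrMask_of_getElem? hu] using hux.symm
    · simpa [← Bool.not_eq_true, testBit_nbrMask_of_getElem? hw, G.adj_comm x w] using hwx
  · simp only [Option.ite_none_right_eq_some, beq_iff_eq, Option.some.injEq] at ho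
    obtain ⟨hpp, rfl⟩ := ho
    obtain ⟨u, hu, hpu⟩ := mem_zipIdx_rows hp
    generalize p.1.log2 = i, (p.1 - 2 ^ p.1.log2).log2 = j at hpp
    obtain ⟨x, hux, hxi, hxj⟩ := hG.exists_adj_ne_ne u (f[i]?.getD u) (f[j]?.getD u)
    refine ⟨x, fun hx => ?_, fits_iff.2 ⟨?_, by simp⟩⟩
    · obtain ⟨k, hk⟩ := List.getElem?_of_mem hx
      have := testBit_of_and_eq hpp (hpu ▸ (testBit_nbrMask_of_getElem? hk).2 hux)
      simp only [Nat.testBit_lor, Nat.testBit_two_pow, Bool.or_eq_true, decide_eq_true_eq] at this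
      rcases this with rfl | rfl
      · simp [hk] at hxi
      · simp [hk] at hxj
    · simpa [testBit_nbrMask_of_getElem? hu] using hux.symm
  · obtain ⟨q, hq, ho⟩ := List.mem_flatMap.1 ho
    obtain ⟨t, ht, ho⟩ := List.mem_filterMap.1 ho
    obtain ⟨hq, hpq⟩ := List.mem_filter.1 hq
    simp only [Option.ite_none_right_eq_some, Bool.and_eq_true, beq_iff_eq,
      Option.some.injEq] at ho
    obtain ⟨⟨⟨hpt, hqt⟩, hall⟩, rfl⟩ := ho
    obtain ⟨a, ha, hpa⟩ := mem_zipIdx_rows hp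
    obtain ⟨b, hb, hqb⟩ := mem_zipIdx_rows hq
    obtain ⟨c, hc, htc⟩ := mem_zipIdx_rows ht
    rw [hpa, testBit_nbrMask_of_getElem? hb] at hpq
    rw [hpa, testBit_nbrMask_of_getElem? hc] at hpt
    rw [hqb, testBit_nbrMask_of_getElem? hc] at hqt
    by_contra! h
    refine hT ⟨a, b, c, hpq.ne, hpt.ne, hqt.ne, hpq, hpt, hqt, fun x _ _ _ => ?_⟩
    by_contra! hx
    by_cases hxf : x ∈ f
    · obtain ⟨i, hi⟩ := List.getElem?_of_mem hxf
      have hif := (List.getElem?_eq_some_iff.1 hi).1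
      have := congrArg (Nat.testBit · i) hall
      simp only [hpa, hqb, htc, Nat.testBit_lor, Nat.testBit_two_pow_sub_one, rows,
        List.length_map, hif, decide_true, Bool.or_eq_true, testBit_nbrMask_of_getElem? hi] at this
      grind [G.adj_comm]
    · refine h x hxf (fits_iff.2 ⟨by simp, ?_⟩)
      simpa [← Bool.not_eq_true, testBit_nbrMask_of_getElem? ha, testBit_nbrMask_of_getElem? hb,
        testBit_nbrMask_of_getElem? hc] using hx

theorem mem_of_shortest?_eq_some {ls : List (List ℕ)} {l : List ℕ}
    (h : shortest? ls = some l) : l ∈ ls := by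
  induction ls generalizing l with
  | nil => simp [shortest?] at h
  | cons a ls ih =>
    rw [shortest?] at h
    split at h
    · simp_all
    · split_ifs at h <;> simp_all

theorem mem_children (hG : ¬ HasPattern G) {f : List V} {x y : V} (hf : (y :: x :: f).Nodup)
    {cands : List ℕ} (hy : nbrMask G f y ∈ cands) :
    nbrMask G (x :: f) y ∈ children (rows G f) cands (nbrMask G f x) := by
  rw [children, List.mem_filter, List.mem_flatMap, withList_eq, ← rows_cons, ← rows_cons,
    Bool.not_eq_true']
  refine ⟨⟨_, hy, ?_⟩, Bool.eq_false_iff.2 fun h => hG (hasPattern_of_bad hf h)⟩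
  by_cases h : G.Adj y x <;> simp [nbrMask, h]

theorem branch_eq_false (hG : ¬ HasPattern G) {f : List V} (hf : f.Nodup)
    {next : List ℕ → List ℕ → Bool}
    (hnext : ∀ x ∉ f, ∀ cands, (∀ y ∉ x :: f, nbrMask G (x :: f) y ∈ cands) →
      next (rows G (x :: f)) cands = false)
    {todo cands : List ℕ} (hcands : ∀ y ∉ f, nbrMask G f y ∈ cands)
    (htodo : ∃ x ∉ f, nbrMask G f x ∈ todo) : branch next (rows G f) todo cands = false := by
  induction todo generalizing cands with
  | nil => simp at htodo
  | cons c todo ih =>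
    rw [branch, withList_eq, withList_eq, Bool.and_eq_false_iff]
    by_cases hc : ∃ x ∉ f, nbrMask G f x = c
    · obtain ⟨x, hx, rfl⟩ := hc
      left
      rw [← rows_cons]
      refine hnext x hx _ fun y hy =>
        mem_children hG ?_ (hcands y (List.not_mem_of_not_mem_cons hy))
      exact List.nodup_cons.2 ⟨hy, List.nodup_cons.2 ⟨hx, hf⟩⟩
    · push Not at hc
      right
      refine ih (fun y hy => List.mem_filter.2 ⟨hcands y hy, bne_iff_ne.2 (hc y hy)⟩) ?_
      obtain ⟨x, hx, h⟩ := htodo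
      exact ⟨x, hx, (List.mem_cons.1 h).resolve_left (hc x hx)⟩

theorem search_eq_false (hG : IsMN3P5 G) (hT : ¬ ∃ a b c, IsDomClique3 G a b c)
    (hP : ¬ HasPattern G) (k : ℕ) {f : List V} (hf : f.Nodup) {cands : List ℕ}
    (hcands : ∀ y ∉ f, nbrMask G f y ∈ cands) : search k (rows G f) cands = false := by
  induction k generalizing f cands with
  | zero => rfl
  | succ k ih =>
    rw [search]
    split
    · rfl
    · next todo h =>
      obtain ⟨o, ho, rfl⟩ := List.mem_map.1 (mem_of_shortest?_eq_some h)
      obtain ⟨x, hx, hox⟩ := exists_fits_of_mem_demands hG hT hf ho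
      rw [withList_eq]
      exact branch_eq_false hP hf (fun x hx _ => ih (List.nodup_cons.2 ⟨hx, hf⟩)) hcands
        ⟨x, hx, List.mem_filter.2 ⟨hcands x hx, hox⟩⟩

theorem search_hole : search 6 holeRows holeCands = true := by decide +kernel

theorem rows_ofFn_of_isFiveHole {v : Fin 5 → V} (hv : IsFiveHole G v) :
    rows G (List.ofFn v) = holeRows := by
  simp [rows, nbrMask, hv.2, holeRows]

theorem nbrMask_lt (f : List V) (x : V) : nbrMask G f x < 2 ^ f.length := by
  induction f with
  | nil => simp [nbrMask]
  | cons v t ih =>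
    rw [nbrMask, List.length_cons, pow_succ]
    split_ifs <;> omega

theorem hasPattern_of_dominating_fiveHole (hG : IsMN3P5 G) (hT : ¬ ∃ a b c, IsDomClique3 G a b c)
    {v : Fin 5 → V} (hv : IsFiveHole G v)
    (hdom : ∀ x : V, (∀ i : Fin 5, x ≠ v i) → ∃ i : Fin 5, G.Adj x (v i)) : HasPattern G := by
  by_contra hP
  have hf : (List.ofFn v).Nodup := List.nodup_ofFn.2 hv.1
  have hcands : ∀ y ∉ List.ofFn v, nbrMask G (List.ofFn v) y ∈ holeCands := by
    intro y hy
    rw [holeCands, List.mem_filter, List.mem_range, withList_eq, ← rows_ofFn_of_isFiveHole hv,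
      ← rows_cons, Bool.and_eq_true, bne_iff_ne, Bool.not_eq_true']
    refine ⟨by simpa using nbrMask_lt (G := G) (List.ofFn v) y, fun h => ?_,
      Bool.eq_false_iff.2 fun h => hP (hasPattern_of_bad (List.nodup_cons.2 ⟨hy, hf⟩) h)⟩
    obtain ⟨i, hi⟩ := hdom y fun i h => hy (List.mem_ofFn.2 ⟨i, h.symm⟩)
    have := (testBit_nbrMask_of_getElem? (G := G) (f := List.ofFn v) (i := i) (w := v i)
      (by rw [List.getElem?_ofFn, dif_pos i.2])).2 hi
    rw [h, Nat.zero_testBit] at this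
    exact Bool.false_ne_true this
  have := search_eq_false hG hT hP 6 hf hcands
  rw [rows_ofFn_of_isFiveHole hv, search_hole] at this
  exact absurd this.symm Bool.false_ne_true

end MaskSearch

theorem mn3p5_dom_five_hole
    {V : Type*} [Fintype V] (G : SimpleGraph V) (hG : IsMN3P5 G)
    (v : Fin 5 → V) (hC : IsFiveHole G v)
    (hdom : ∀ x : V, (∀ i : Fin 5, x ≠ v i) → ∃ i : Fin 5, G.Adj x (v i)) :
    (∃ a b c : V, IsDomClique3 G a b c) ∨ IsoToSix G := by
  by_cases hT : ∃ a b c, IsDomClique3 G a b c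
  · exact .inl hT
  · right
    rcases MaskSearch.hasPattern_of_dominating_fiveHole hG hT hC hdom with h | h | h
    · exact absurd h hG.1
    · exact .inl (hG.nonempty_iso p5Free_graphK4 not_colorable_graphK4 h)
    · exact .inr (.inr (.inl (hG.nonempty_iso p5Free_graphS1 not_colorable_graphS1 h)))
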